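/- Radial monotonicity of the ground state: let Q : ℝ³ → ℝ be the ground state, i.e. the unique positive radial smooth solution of −ΔQ + Q − Q² = 0 on ℝ³ vanishing at infinity with Q, ∇Q ∈ L²(ℝ³), and write Q(p) = q(|p|) for a function q : [0,∞) → ℝ. Then q is strictly decreasing on (0,∞); equivalently, the radial derivative ∂_r Q(r) is negative for every r > 0. -/

import Mathlib

noncomputable section

open MeasureTheory Filter Real

/-- Partial derivative in the first spatial variable. -/
def pdx (f : ℝ → ℝ → ℝ → ℝ) (x y z : ℝ) : ℝ := deriv (fun a => f a y z) x

/-- Partial derivative in the second spatial variable. -/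
def pdy (f : ℝ → ℝ → ℝ → ℝ) (x y z : ℝ) : ℝ := deriv (fun b => f x b z) y

/-- Partial derivative in the third spatial variable. -/
def pdz (f : ℝ → ℝ → ℝ → ℝ) (x y z : ℝ) : ℝ := deriv (fun c => f x y c) z

/-- Spatial Laplacian Δf = f_xx + f_yy + f_zz of a function of three real variables. -/
def lap3 (f : ℝ → ℝ → ℝ → ℝ) (x y z : ℝ) : ℝ :=
  deriv (fun a => deriv (fun a' => f a' y z) a) x
    + deriv (fun b => deriv (fun b' => f x b' z) b) y
    + deriv (fun c => deriv (fun c' => f x y c') c) z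

/-- `u` solves the 3D Zakharov–Kuznetsov equation ∂ₜu + ∂ₓ(Δu + u²) = 0 pointwise. -/
def IsZKSolution (u : ℝ → ℝ → ℝ → ℝ → ℝ) : Prop :=
  ∀ t x y z : ℝ,
    deriv (fun s => u s x y z) t
      + deriv (fun a => lap3 (u t) a y z + (u t a y z) ^ 2) x = 0

/-- `t ↦ u(t,·)` is a smooth curve in the Schwartz space 𝒮(ℝ³): the function is jointly
smooth and every time derivative of every time slice is a Schwartz function. -/
def IsSchwartzCurve (u : ℝ → ℝ → ℝ → ℝ → ℝ) : Prop :=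
  ContDiff ℝ (⊤ : ℕ∞) (fun p : ℝ × ℝ × ℝ × ℝ => u p.1 p.2.1 p.2.2.1 p.2.2.2) ∧
    ∀ (n : ℕ) (t : ℝ), ∃ S : SchwartzMap (ℝ × ℝ × ℝ) ℝ,
      ∀ x y z : ℝ, S (x, y, z) = iteratedDeriv n (fun s => u s x y z) t

/-- `Q` is the ground state: a positive radial smooth solution of −ΔQ + Q − Q² = 0 on ℝ³,
vanishing at infinity, with Q and ∇Q square-integrable. -/
def IsGroundState (Q : ℝ → ℝ → ℝ → ℝ) : Prop :=
  ContDiff ℝ (⊤ : ℕ∞) (fun p : ℝ × ℝ × ℝ => Q p.1 p.2.1 p.2.2) ∧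
  (∀ x y z : ℝ, 0 < Q x y z) ∧
  (∃ q : ℝ → ℝ, ∀ x y z : ℝ, Q x y z = q (Real.sqrt (x ^ 2 + y ^ 2 + z ^ 2))) ∧
  Tendsto (fun p : ℝ × ℝ × ℝ => Q p.1 p.2.1 p.2.2) (cocompact (ℝ × ℝ × ℝ)) (nhds 0) ∧
  Integrable (fun p : ℝ × ℝ × ℝ => (Q p.1 p.2.1 p.2.2) ^ 2) ∧
  Integrable (fun p : ℝ × ℝ × ℝ =>
    (pdx Q p.1 p.2.1 p.2.2) ^ 2 + (pdy Q p.1 p.2.1 p.2.2) ^ 2 + (pdz Q p.1 p.2.1 p.2.2) ^ 2) ∧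
  (∀ x y z : ℝ, -(lap3 Q x y z) + Q x y z - (Q x y z) ^ 2 = 0)

open Topology in
/-- A function vanishing at `0` which is strictly decreasing at each of its nonnegative zeros is
negative on `(0, ∞)`. -/
lemma neg_of_deriv_neg_at_zeros {g : ℝ → ℝ} (hg : Continuous g) (h0 : g 0 = 0)
    (hz : ∀ r, 0 ≤ r → g r = 0 → deriv g r < 0) {r : ℝ} (hr : 0 < r) : g r < 0 := by
  by_contra! hgr
  have hright : ∀ᶠ x in 𝓝[>] (0 : ℝ), g x < 0 := by
    filter_upwards [(eventually_nhdsWithin_sign_eq_of_deriv_neg (hz 0 le_rfl h0) h0).filter_mono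
      nhdsWithin_le_nhds, self_mem_nhdsWithin] with x hx hx0
    rw [← sign_eq_neg_one_iff, hx, sign_eq_neg_one_iff]
    simpa using hx0
  obtain ⟨d, hd, hdneg⟩ := mem_nhdsGT_iff_exists_Ioo_subset.mp hright
  simp only [Set.mem_Ioi] at hd
  have hdr : d ≤ r := by
    by_contra! hlt
    exact absurd (hdneg ⟨hr, hlt⟩) (not_lt.mpr hgr)
  have hcompact : IsCompact (Set.Icc d r ∩ {x | 0 ≤ g x}) :=
    isCompact_Icc.inter_right (isClosed_le continuous_const hg)
  obtain ⟨s, ⟨⟨hds, hsr⟩, hgs⟩, hleast⟩ := hcompact.exists_isLeast ⟨r, ⟨hdr, le_rfl⟩, hgr⟩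
  have hs : 0 < s := hd.trans_le hds
  have hbefore : ∀ x, 0 < x → x < s → g x < 0 := by
    intro x hx hxs
    by_cases hxd : x < d
    · exact hdneg ⟨hx, hxd⟩
    · by_contra! hgx
      exact absurd (hleast ⟨⟨not_lt.mp hxd, hxs.le.trans hsr⟩, hgx⟩) (not_le.mpr hxs)
  have hleft : ∀ᶠ x in 𝓝[<] s, g x < 0 := by
    filter_upwards [Ioo_mem_nhdsLT hs] with x hx using hbefore x hx.1 hx.2
  have hgs0 : g s = 0 := le_antisymm
    (le_of_tendsto (hg.continuousAt.tendsto.mono_left nhdsWithin_le_nhds)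
      (hleft.mono fun _ h => h.le)) hgs
  obtain ⟨x, hxneg, hxsign, hxs⟩ := (hleft.and
    (((eventually_nhdsWithin_sign_eq_of_deriv_neg (hz s hs.le hgs0) hgs0).filter_mono
      nhdsWithin_le_nhds).and self_mem_nhdsWithin)).exists
  rw [sign_eq_neg_one_iff.mpr hxneg, eq_comm, sign_eq_neg_one_iff, sub_neg] at hxsign
  exact lt_asymm hxsign hxs

/-- Second derivative at `0` of a radial profile along a direction tangential to the sphere of
radius `r`. -/
lemma deriv_deriv_tangential {f : ℝ → ℝ} (hf : ContDiff ℝ 2 f) {r : ℝ} (hr : 0 < r) :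
    deriv (fun b => deriv (fun b' => f √(r ^ 2 + b' ^ 2)) b) 0 = deriv f r / r := by
  have hpos : ∀ b : ℝ, 0 < r ^ 2 + b ^ 2 := fun b => by positivity
  have hsqrt : ∀ b : ℝ, HasDerivAt (fun b' => √(r ^ 2 + b' ^ 2)) (b / √(r ^ 2 + b ^ 2)) b := by
    intro b
    have h := (((hasDerivAt_pow 2 b).const_add (r ^ 2)).sqrt (hpos b).ne')
    convert h using 1
    field_simp
    norm_num [mul_comm]
  have hf' : ContDiff ℝ 1 (deriv f) := ((contDiff_succ_iff_deriv (n := 1)).mp hf).2.2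
  have hfirst : (fun b => deriv (fun b' => f √(r ^ 2 + b' ^ 2)) b)
      = fun b => deriv f √(r ^ 2 + b ^ 2) * (b / √(r ^ 2 + b ^ 2)) := by
    funext b
    exact (((hf.differentiable (by norm_num)) _).hasDerivAt.comp b (hsqrt b)).deriv
  have hs0 : √(r ^ 2 + (0 : ℝ) ^ 2) = r := by simp [Real.sqrt_sq hr.le]
  have hd : HasDerivAt (fun b => deriv f √(r ^ 2 + b ^ 2) * (b / √(r ^ 2 + b ^ 2))) _ 0 :=
    (((hf'.differentiable (by norm_num)) _).hasDerivAt.comp 0 (hsqrt 0)).mul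
      ((hasDerivAt_id (0 : ℝ)).div (hsqrt 0) (by rw [hs0]; exact hr.ne'))
  rw [hfirst, hd.deriv]
  simp only [Function.comp, hs0, id]
  field_simp
  ring

/-- Along a solution of `φ'' + (2 / r) φ' = φ - φ²` decaying at infinity, the energy
`φ'² / 2 - φ² / 2 + φ³ / 3` is nonnegative. -/
lemma radial_energy_nonneg {f : ℝ → ℝ} (hf : ContDiff ℝ 2 f)
    (hode : ∀ r, 0 < r → deriv (deriv f) r + 2 * (deriv f r / r) = f r - f r ^ 2)
    (hlim : Tendsto f atTop (nhds 0)) {r : ℝ} (hr : 0 ≤ r) :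
    0 ≤ deriv f r ^ 2 / 2 - f r ^ 2 / 2 + f r ^ 3 / 3 := by
  have hf' : ContDiff ℝ 1 (deriv f) := ((contDiff_succ_iff_deriv (n := 1)).mp hf).2.2
  have hanti : AntitoneOn (fun r => deriv f r ^ 2 / 2 - f r ^ 2 / 2 + f r ^ 3 / 3)
      (Set.Ici 0) := by
    have hderiv : ∀ x, HasDerivAt (fun r => deriv f r ^ 2 / 2 - f r ^ 2 / 2 + f r ^ 3 / 3)
        (deriv f x * (deriv (deriv f) x - f x + f x ^ 2)) x := by
      intro x
      have h1 := ((hf.differentiable (by norm_num)) x).hasDerivAt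
      have h2 := ((hf'.differentiable (by norm_num)) x).hasDerivAt
      refine ((((h2.pow 2).div_const 2).sub ((h1.pow 2).div_const 2)).add
        ((h1.pow 3).div_const 3)).congr_deriv ?_
      push_cast
      ring
    refine antitoneOn_of_deriv_nonpos (convex_Ici 0)
      (fun x _ => (hderiv x).continuousAt.continuousWithinAt)
      (fun x _ => (hderiv x).differentiableAt.differentiableWithinAt) fun x hx => ?_
    rw [interior_Ici, Set.mem_Ioi] at hx
    have heq : deriv f x * (deriv (deriv f) x - f x + f x ^ 2) = -(2 * (deriv f x ^ 2 / x)) := by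
      rw [eq_sub_of_add_eq (hode x hx)]
      ring
    rw [(hderiv x).deriv, heq]
    have : 0 ≤ deriv f x ^ 2 / x := by positivity
    linarith
  have hpot : Tendsto (fun R => -(f R ^ 2 / 2) + f R ^ 3 / 3) atTop (nhds 0) := by
    simpa using ((hlim.pow 2).div_const 2).neg.add ((hlim.pow 3).div_const 3)
  refine le_of_tendsto hpot ?_
  filter_upwards [eventually_ge_atTop r] with R hR
  have h := hanti (Set.mem_Ici.mpr hr) (Set.mem_Ici.mpr (hr.trans hR)) hR
  simp only at h
  nlinarith [sq_nonneg (deriv f R)]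

/-- radial monotonicity of the ground state: writing Q(p) = q(|p|),
the profile q is strictly decreasing on (0,∞). -/
theorem zk_ground_state_radial_monotone (Q : ℝ → ℝ → ℝ → ℝ) (hQ : IsGroundState Q)
    (q : ℝ → ℝ)
    (hq : ∀ x y z : ℝ, Q x y z = q (Real.sqrt (x ^ 2 + y ^ 2 + z ^ 2))) :
    StrictAntiOn q (Set.Ioi 0) := by
  obtain ⟨hsmooth, hpos, -, hdecay, -, -, heq⟩ := hQ
  set f : ℝ → ℝ := fun r => Q r 0 0 with hfdef
  have hf : ContDiff ℝ 2 f :=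
    (contDiff_infty.mp hsmooth 2).comp
      (contDiff_id.prodMk (contDiff_const (c := ((0 : ℝ), (0 : ℝ)))))
  have hfq : ∀ r, 0 ≤ r → f r = q r := fun r hr => by
    simp [hfdef, hq, Real.sqrt_sq hr]
  have hQf : ∀ x y z, Q x y z = f √(x ^ 2 + y ^ 2 + z ^ 2) := fun x y z => by
    rw [hfq _ (Real.sqrt_nonneg _), hq]
  have hlim : Tendsto f atTop (nhds 0) := by
    refine hdecay.comp (g := fun p : ℝ × ℝ × ℝ => Q p.1 p.2.1 p.2.2)
      (f := fun r : ℝ => (r, (0 : ℝ), (0 : ℝ))) ?_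
    rw [← Metric.cobounded_eq_cocompact, ← tendsto_norm_atTop_iff_cobounded]
    refine tendsto_atTop_mono (fun r => ?_) tendsto_id
    exact (le_abs_self r).trans (norm_fst_le ((r, (0 : ℝ), (0 : ℝ)) : ℝ × ℝ × ℝ))
  have hode : ∀ r, 0 < r → deriv (deriv f) r + 2 * (deriv f r / r) = f r - f r ^ 2 := by
    intro r hr
    have h := heq r 0 0
    have hy : (fun b' => Q r b' 0) = fun b' => f √(r ^ 2 + b' ^ 2) := by
      funext b; simp [hQf r b 0]
    have hz : (fun c' => Q r 0 c') = fun c' => f √(r ^ 2 + c' ^ 2) := by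
      funext c; simp [hQf r 0 c]
    rw [lap3, hy, hz, deriv_deriv_tangential hf hr] at h
    change -(deriv (deriv f) r + _ + _) + f r - f r ^ 2 = 0 at h
    linarith
  have hode0 : 3 * deriv (deriv f) 0 = f 0 - f 0 ^ 2 := by
    have h := heq 0 0 0
    have hy : (fun b' => Q 0 b' 0) = f := by
      funext b; simp [hfdef, hq]
    have hz : (fun c' => Q 0 0 c') = f := by
      funext c; simp [hfdef, hq]
    rw [lap3, hy, hz] at h
    change -(deriv (deriv f) 0 + deriv (deriv f) 0 + deriv (deriv f) 0) + f 0 - f 0 ^ 2 = 0 at h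
    linarith
  have hf'0 : deriv f 0 = 0 := by
    have heven : (fun x => f (-x)) = f := by
      funext x; simp [hfdef, hq]
    have h := deriv_comp_neg f 0
    rw [heven, neg_zero] at h
    linarith
  have hzeros : ∀ r, 0 ≤ r → deriv f r = 0 → deriv (deriv f) r < 0 := by
    intro r hr hcrit
    have hE := radial_energy_nonneg hf hode hlim hr
    have hfr : 0 < f r := hpos r 0 0
    have hlarge : 1 < f r := by
      by_contra! hle
      rw [hcrit] at hE
      nlinarith [pow_pos hfr 2]
    rcases hr.eq_or_lt with rfl | hr
    · nlinarith
    · have h := hode r hr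
      rw [hcrit] at h
      simp only [zero_div, mul_zero, add_zero] at h
      nlinarith
  have hanti : StrictAntiOn f (Set.Ioi 0) := by
    refine strictAntiOn_of_deriv_neg (convex_Ioi 0) hf.continuous.continuousOn fun r hr => ?_
    rw [interior_Ioi] at hr
    exact neg_of_deriv_neg_at_zeros (hf.continuous_deriv (by norm_num)) hf'0 hzeros hr
  exact hanti.congr fun r hr => hfq r (le_of_lt hr)
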